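/- arXiv:0907.4436 — 2 statements merged into one kernel-verified Lean document; each statement's English description precedes it below -/
import Mathlib

section
/- Let K be a field and α, β ∈ K nonzero with α ≠ β. Let p, q, r, s be non-negative integers with p ≥ r and q ≥ s, and let K_{p,q} := diag(α·I_p, β·I_q) ∈ M_{p+q}(K), K_{r,s} := diag(α·I_r, β·I_s) ∈ M_{r+s}(K), and J_{p,q,r,s} ∈ M_{p+q, r+s}(K) be the block matrix whose first r columns are (I_r; 0_{p−r,r}; 0_{s,r}; 0_{q−s,r}) and whose last s columns are (0_{r,s}; 0_{p−r,s}; −I_s; 0_{q−s,s}). If the block matrix M = [[K_{p,q}, J_{p,q,r,s}],[0, K_{r,s}]] ∈ M_{p+q+r+s}(K) is an (α,β)-composite, then q ≥ r and p ≥ s. -/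
/-- A matrix is an `(a,b)`-composite if it is `a•P + b•Q` for some idempotents `P, Q`. -/
def Matrix.IsABComposite {K : Type*} [Field K] {m : Type*} [Fintype m] [DecidableEq m]
    (a b : K) (A : Matrix m m K) : Prop :=
  ∃ P Q : Matrix m m K, P * P = P ∧ Q * Q = Q ∧ A = a • P + b • Q

theorem idempotent_relations {K R : Type*} [Field K] [Ring R] [Algebra K R] (α β : K)
    {P Q : R} (hP : P * P = P) (hQ : Q * Q = Q) {A E : R} (hA : A = α • P + β • Q)
    (hE : E = (A - α • 1) * (A - β • 1)) :
    P * E = E * P ∧ α • (P * A + A * P) = (α * (α + β)) • P + α • A - (α * β) • 1 + E := by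
  have hE' : E = (α * β) • (1 - P - Q + P * Q + Q * P) := by
    subst hE hA
    simp only [mul_add, add_mul, mul_sub, sub_mul, smul_mul_assoc, mul_smul_comm, hP, hQ, mul_one,
      one_mul]
    module
  have hPP : ∀ x, P * (P * x) = P * x := fun x => by rw [← mul_assoc, hP]
  constructor
  · rw [hE']
    simp only [mul_add, add_mul, mul_sub, sub_mul, smul_mul_assoc, mul_smul_comm, hP, hPP, mul_one,
      one_mul, mul_assoc]
    module
  · rw [hE', hA]
    simp only [mul_add, add_mul, smul_mul_assoc, mul_smul_comm, hP]
    module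

namespace Matrix

theorem rank_add_le {K m n : Type*} [Field K] [Finite m] [Fintype n]
    (A B : Matrix m n K) : (A + B).rank ≤ A.rank + B.rank := by
  rw [rank, rank, rank, mulVecLin_add]
  refine (Submodule.finrank_mono ?_).trans (Submodule.finrank_add_le_finrank_add_finrank _ _)
  rintro _ ⟨x, rfl⟩
  exact Submodule.add_mem_sup ⟨x, rfl⟩ ⟨x, rfl⟩

variable {K : Type*} [Field K] {m n k l : Type*} [Fintype m] [Fintype n] [Fintype k] [Fintype l]
  [DecidableEq k]

theorem eq_zero_of_mul_eq_zero_of_left_inverse {o : Type*} {L : Matrix k m K} {J : Matrix m k K}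
    (h : L * J = 1) {X : Matrix k o K} (hX : J * X = 0) : X = 0 := by
  rw [← Matrix.one_mul X, ← h, Matrix.mul_assoc, hX, Matrix.mul_zero]

theorem rank_le_of_mul_eq_mul {o : Type*} [Fintype o] {L : Matrix k m K}
    {J : Matrix m k K} (h : L * J = 1)
    {X : Matrix k l K} {Y : Matrix m o K} {Z : Matrix o l K} (hX : J * X = Y * Z) :
    X.rank ≤ Y.rank := by
  rw [← Matrix.one_mul X, ← h, Matrix.mul_assoc, hX]
  exact (rank_mul_le_right _ _).trans (rank_mul_le_left _ _)

theorem card_le_rank_add_rank {L : Matrix k m K} {J : Matrix m k K} (h : L * J = 1) {κ : K}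
    (hκ : κ ≠ 0) {X : Matrix m n K} {Y : Matrix n k K} {Z : Matrix m l K} {W : Matrix l k K}
    (hJ : κ • J = X * Y + Z * W) : Fintype.card k ≤ X.rank + W.rank := by
  have h1 : (1 : Matrix k k K) = (κ⁻¹ • L) * (X * Y) + (κ⁻¹ • L) * (Z * W) := by
    rw [← Matrix.mul_add, ← hJ, smul_mul, Matrix.mul_smul, smul_smul, inv_mul_cancel₀ hκ,
      one_smul, h]
  rw [← rank_one (R := K) (n := k), h1]
  refine (rank_add_le _ _).trans (add_le_add ?_ ?_)
  · exact (rank_mul_le_right _ _).trans (rank_mul_le_left _ _)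
  · exact (rank_mul_le_right _ _).trans (rank_mul_le_right _ _)

variable [DecidableEq m] [DecidableEq n] [DecidableEq l]

theorem card_le_of_isABComposite_fromBlocks {α β : K} (hα : α ≠ 0) (hβ : β ≠ 0) (hne : α ≠ β)
    {J₁ : Matrix m k K} {L₁ : Matrix k m K} (h₁ : L₁ * J₁ = 1)
    {J₂ : Matrix n l K} {L₂ : Matrix l n K} (h₂ : L₂ * J₂ = 1)
    (hM : IsABComposite α β (fromBlocks (fromBlocks (α • 1) 0 0 (β • 1))
      (fromBlocks J₁ 0 0 (-J₂)) 0 (fromBlocks (α • 1) 0 0 (β • 1)))) :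
    Fintype.card k ≤ Fintype.card n ∧ Fintype.card l ≤ Fintype.card m := by
  obtain ⟨P, Q, hP, hQ, hA⟩ := hM
  obtain ⟨hcomm, hrel⟩ := idempotent_relations α β hP hQ hA rfl
  obtain ⟨P₁, P₂, R, P₃, rfl⟩ : ∃ P₁ P₂ R P₃, P = fromBlocks P₁ P₂ R P₃ :=
    ⟨_, _, _, _, (fromBlocks_toBlocks P).symm⟩
  obtain ⟨a, b, c, d, rfl⟩ : ∃ a b c d, P₁ = fromBlocks a b c d :=
    ⟨_, _, _, _, (fromBlocks_toBlocks P₁).symm⟩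
  obtain ⟨e, f, g, h, rfl⟩ : ∃ a b c d, P₂ = fromBlocks a b c d :=
    ⟨_, _, _, _, (fromBlocks_toBlocks P₂).symm⟩
  obtain ⟨r, s, t, u, rfl⟩ : ∃ a b c d, R = fromBlocks a b c d :=
    ⟨_, _, _, _, (fromBlocks_toBlocks R).symm⟩
  obtain ⟨a', b', c', d', rfl⟩ : ∃ a b c d, P₃ = fromBlocks a b c d :=
    ⟨_, _, _, _, (fromBlocks_toBlocks P₃).symm⟩
  clear hQ hA
  have hE : (fromBlocks (fromBlocks (α • 1 : Matrix m m K) 0 0 (β • 1 : Matrix n n K))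
        (fromBlocks J₁ 0 0 (-J₂)) 0
        (fromBlocks (α • 1 : Matrix k k K) 0 0 (β • 1 : Matrix l l K)) - α • 1) *
      (fromBlocks (fromBlocks (α • 1 : Matrix m m K) 0 0 (β • 1 : Matrix n n K))
        (fromBlocks J₁ 0 0 (-J₂)) 0
        (fromBlocks (α • 1 : Matrix k k K) 0 0 (β • 1 : Matrix l l K)) - β • 1) =
      fromBlocks 0 (fromBlocks ((α - β) • J₁) 0 0 ((α - β) • J₂)) 0 0 := by
    simp [← fromBlocks_one, ← fromBlocks_zero, fromBlocks_smul, sub_eq_add_neg, fromBlocks_neg,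
      fromBlocks_add, fromBlocks_multiply, fromBlocks_inj]
    simp only [← sub_eq_add_neg, ← sub_smul, Matrix.mul_smul, Matrix.smul_mul, Matrix.mul_one,
      Matrix.one_mul]
    exact ⟨trivial, by module⟩
  rw [hE] at hcomm hrel
  simp [← fromBlocks_one, ← fromBlocks_zero, fromBlocks_smul, sub_eq_add_neg, fromBlocks_neg,
    fromBlocks_add, fromBlocks_multiply, fromBlocks_inj] at hcomm hrel hP
  have hγ : α + -β ≠ 0 := by rwa [← sub_eq_add_neg, sub_ne_zero]
  have hδ : α * (α + -β) ≠ 0 := mul_ne_zero hα hγ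
  obtain ⟨⟨hr, hs, ht, hu⟩, ⟨-, hb, hc, -⟩, -⟩ := hcomm
  have hr := eq_zero_of_mul_eq_zero_of_left_inverse h₁ ((smul_eq_zero_iff_right hγ).1 hr.symm)
  have hs := eq_zero_of_mul_eq_zero_of_left_inverse h₁ ((smul_eq_zero_iff_right hγ).1 hs.symm)
  have ht := eq_zero_of_mul_eq_zero_of_left_inverse h₂ ((smul_eq_zero_iff_right hγ).1 ht.symm)
  have hu := eq_zero_of_mul_eq_zero_of_left_inverse h₂ ((smul_eq_zero_iff_right hγ).1 hu.symm)
  have hb := smul_right_injective _ hγ hb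
  have hc := smul_right_injective _ hγ hc
  subst hr hs ht hu
  simp only [Matrix.mul_zero, Matrix.zero_mul, smul_zero, neg_zero, add_zero, zero_add] at hrel hP
  obtain ⟨⟨ha, -, -, hd⟩, ⟨he, -, -, hh⟩, -, ha', -, -, hd'⟩ := hrel
  obtain ⟨⟨hbc, -, -, hcb⟩, ⟨hJ₁, -, -, hJ₂⟩, -⟩ := hP
  obtain rfl : a = 1 := smul_right_injective _ hδ
    (by linear_combination (norm := module) ha)
  obtain rfl : a' = 1 := smul_right_injective _ hδ
    (by linear_combination (norm := module) ha')
  obtain rfl : d = 0 := smul_right_injective _ hδ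
    (by linear_combination (norm := module) -hd)
  obtain rfl : d' = 0 := smul_right_injective _ hδ
    (by linear_combination (norm := module) -hd')
  simp only [Matrix.mul_zero, Matrix.zero_mul, Matrix.mul_one, Matrix.one_mul, smul_zero, neg_zero,
    add_zero, zero_add] at he hh hbc hcb hJ₁ hJ₂
  rw [add_eq_left] at hbc
  have hκ : β / (α * (α + -β)) ≠ 0 := div_ne_zero hβ hδ
  have hk : (β / (α * (α + -β))) • J₁ = b * g + f * c' := by
    refine smul_right_injective _ hδ ?_
    simp only [smul_smul, mul_div_cancel₀ _ hδ]
    linear_combination (norm := module) he - (α * (α + -β)) • hJ₁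
  have hl : (β / (α * (α + -β))) • J₂ = c * f + g * b' := by
    rw [hJ₂]
    refine smul_right_injective _ hδ ?_
    simp only [smul_smul, mul_div_cancel₀ _ hδ]
    linear_combination (norm := module) hh
  have hk := card_le_rank_add_rank h₁ hκ hk
  have hl := card_le_rank_add_rank h₂ hκ hl
  have hb := rank_le_of_mul_eq_mul h₁ hb.symm
  have hc := rank_le_of_mul_eq_mul h₂ hc.symm
  have hbc := rank_add_rank_le_card_of_mul_eq_zero hbc
  have hcb := rank_add_rank_le_card_of_mul_eq_zero hcb
  omega

theorem of_ite_val_mul_of_ite_val {a b : ℕ} (hab : a ≤ b) :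
    (of fun (i : Fin a) (j : Fin b) => if (i : ℕ) = (j : ℕ) then (1 : K) else 0) *
      (of fun (i : Fin b) (j : Fin a) => if (i : ℕ) = (j : ℕ) then (1 : K) else 0) = 1 := by
  ext i j
  rw [mul_apply, Finset.sum_eq_single (Fin.castLE hab i)]
  · simp [one_apply, Fin.ext_iff]
  · intro x _ hx
    have : (i : ℕ) ≠ x := fun h => hx (Fin.ext h.symm)
    simp [this]
  · simp

end Matrix

/-- Intertwinement lemma: if the block matrix `[[K_{p,q}, J_{p,q,r,s}],[0, K_{r,s}]]`
is an `(α,β)`-composite, then `q ≥ r` and `p ≥ s`. -/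
theorem intertwinement_lemma
    {K : Type*} [Field K] (α β : K) (hα : α ≠ 0) (hβ : β ≠ 0) (hne : α ≠ β)
    (p q r s : ℕ) (hpr : r ≤ p) (hqs : s ≤ q)
    (hM : Matrix.IsABComposite α β
      (Matrix.fromBlocks
        (Matrix.fromBlocks (α • 1) 0 0 (β • 1) :
          Matrix (Fin p ⊕ Fin q) (Fin p ⊕ Fin q) K)
        (Matrix.of fun i j =>
          match i, j with
          | Sum.inl i, Sum.inl j => if (i : ℕ) = (j : ℕ) then (1 : K) else 0
          | Sum.inl _, Sum.inr _ => 0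
          | Sum.inr _, Sum.inl _ => 0
          | Sum.inr i, Sum.inr j => if (i : ℕ) = (j : ℕ) then (-1 : K) else 0 :
          Matrix (Fin p ⊕ Fin q) (Fin r ⊕ Fin s) K)
        0
        (Matrix.fromBlocks (α • 1) 0 0 (β • 1) :
          Matrix (Fin r ⊕ Fin s) (Fin r ⊕ Fin s) K))) :
    r ≤ q ∧ s ≤ p := by
  have h₁ : (Matrix.of fun (i : Fin r) (j : Fin p) => if (i : ℕ) = (j : ℕ) then (1 : K) else 0) *
      (Matrix.of fun (i : Fin p) (j : Fin r) => if (i : ℕ) = (j : ℕ) then (1 : K) else 0) = 1 :=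
    Matrix.of_ite_val_mul_of_ite_val hpr
  have h₂ : (Matrix.of fun (i : Fin s) (j : Fin q) => if (i : ℕ) = (j : ℕ) then (1 : K) else 0) *
      (Matrix.of fun (i : Fin q) (j : Fin s) => if (i : ℕ) = (j : ℕ) then (1 : K) else 0) = 1 :=
    Matrix.of_ite_val_mul_of_ite_val hqs
  have h := Matrix.card_le_of_isABComposite_fromBlocks hα hβ hne h₁ h₂ (by
    convert hM using 2
    ext (i | i) (j | j) <;> simp [apply_ite])
  simpa using h
end

section
/- Let K be a field and α, β ∈ K nonzero with α ≠ β, and let n ≥ 1. Then each of the three block-diagonal matrices diag(J_α(n), J_β(n)) ∈ M_{2n}(K), diag(J_α(n), J_β(n+1)) ∈ M_{2n+1}(K), and diag(J_α(n+1), J_β(n)) ∈ M_{2n+1}(K) is an (α,β)-composite. -/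
/-- The Jordan block of size `m` associated with the eigenvalue `lam`:
`lam`'s on the diagonal, `1`'s on the superdiagonal. -/
def jordanBlock {K : Type*} [Field K] (m : ℕ) (lam : K) : Matrix (Fin m) (Fin m) K :=
  Matrix.of fun i j => if i = j then lam else if (i : ℕ) + 1 = (j : ℕ) then 1 else 0

open Polynomial in
/-- The Newton-type product `∏_{i < k} (X - l i)` with `l` alternating between `a` and `b`. -/
noncomputable def alternatingProd {K : Type*} [Field K] (a b : K) (k : ℕ) : K[X] :=
  ∏ i ∈ Finset.range k, (X - C (if Even i then a else b))

section

open Polynomial Matrix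

variable {K : Type*} [Field K]

theorem alternatingProd_succ (a b : K) (k : ℕ) :
    alternatingProd a b (k + 1) =
      (X - C (if Even k then a else b)) * alternatingProd a b k := by
  rw [alternatingProd, Finset.prod_range_succ, mul_comm, alternatingProd]

theorem alternatingProd_monic (a b : K) (k : ℕ) : (alternatingProd a b k).Monic :=
  monic_prod_of_monic _ _ fun _ _ => monic_X_sub_C _

theorem natDegree_alternatingProd (a b : K) (k : ℕ) :
    (alternatingProd a b k).natDegree = k := by
  rw [alternatingProd, natDegree_prod_of_monic _ _ fun _ _ => monic_X_sub_C _]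
  simp

theorem alternatingProd_two_mul (a b : K) (n : ℕ) :
    alternatingProd a b (2 * n) = (X - C a) ^ n * (X - C b) ^ n := by
  induction n with
  | zero => simp [alternatingProd]
  | succ n ih =>
    rw [show 2 * (n + 1) = 2 * n + 1 + 1 by ring, alternatingProd_succ, alternatingProd_succ, ih,
      if_neg (by simp), if_pos (by simp)]
    ring

theorem alternatingProd_two_mul_add_one (a b : K) (n : ℕ) :
    alternatingProd a b (2 * n + 1) = (X - C a) ^ (n + 1) * (X - C b) ^ n := by
  rw [alternatingProd_succ, alternatingProd_two_mul, if_pos (by simp)]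
  ring

theorem linearIndependent_alternatingProd (a b : K) :
    LinearIndependent K (alternatingProd a b) := by
  let S : Polynomial.Sequence K :=
    { elems' := alternatingProd a b
      degree_eq' := fun k => by
        rw [degree_eq_natDegree (alternatingProd_monic a b k).ne_zero,
          natDegree_alternatingProd] }
  exact S.linearIndependent

variable {m : Type*} [Fintype m] [DecidableEq m]

/-- A matrix with a cyclic vector whose annihilator is generated by the alternating product
is a composite. -/
theorem Matrix.isABComposite_of_cyclic {a b : K} (ha : a ≠ 0) (hb : b ≠ 0) (A : Matrix m m K)
    (v : m → K) (h0 : aeval A (alternatingProd a b (Fintype.card m)) *ᵥ v = 0)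
    (hdvd : ∀ g : K[X], aeval A g *ᵥ v = 0 → alternatingProd a b (Fintype.card m) ∣ g) :
    A.IsABComposite a b := by
  set N := Fintype.card m with hN
  set e : ℕ → m → K := fun k => aeval A (alternatingProd a b k) *ᵥ v with he
  have hstep : ∀ k, A *ᵥ e k = (if Even k then a else b) • e k + e (k + 1) := by
    intro k
    simp only [he, alternatingProd_succ, map_mul, map_sub, aeval_X, aeval_C, ← mulVec_mulVec,
      sub_mulVec, Algebra.algebraMap_eq_smul_one, smul_mulVec, one_mulVec]
    rw [add_sub_cancel]
  have hli : LinearIndependent K (fun i : Fin N => e i) := by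
    rw [Fintype.linearIndependent_iff]
    intro c hc
    set g : K[X] := ∑ i : Fin N, c i • alternatingProd a b i with hg
    have hgv : aeval A g *ᵥ v = 0 := by
      rw [← hc, hg, map_sum, sum_mulVec]
      exact Finset.sum_congr rfl fun i _ => by rw [map_smul, smul_mulVec]
    have hdeg : g ∈ degreeLT K N := by
      refine Submodule.sum_mem _ fun i _ => Submodule.smul_mem _ _ ?_
      rw [mem_degreeLT, degree_eq_natDegree (alternatingProd_monic a b i).ne_zero,
        natDegree_alternatingProd]
      exact_mod_cast i.2
    have hg0 : g = 0 := by
      refine eq_zero_of_dvd_of_degree_lt (hdvd g hgv) ?_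
      rw [degree_eq_natDegree (alternatingProd_monic a b N).ne_zero, natDegree_alternatingProd]
      exact mem_degreeLT.1 hdeg
    exact Fintype.linearIndependent_iff.1
      ((linearIndependent_alternatingProd a b).comp _ Fin.val_injective) c hg0
  let B : Module.Basis (Fin N) K (m → K) :=
    basisOfLinearIndependentOfCardEqFinrank' _ hli (by simp [hN])
  have hB : ∀ i : Fin N, B i = e i := fun i => by simp [B]
  have key : ∀ w : ℕ → m → K, w N = 0 → ∃ M : Matrix m m K, ∀ k ≤ N, M *ᵥ e k = w k := by
    intro w hw
    refine ⟨LinearMap.toMatrix' (B.constr K fun i : Fin N => w i), fun k hk => ?_⟩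
    rw [LinearMap.toMatrix'_mulVec]
    rcases hk.lt_or_eq with hk | rfl
    · have := B.constr_basis K (fun i : Fin N => w i) ⟨k, hk⟩
      rwa [hB] at this
    · rw [hw, show e N = 0 from h0, map_zero]
  have hext : ∀ M M' : Matrix m m K, (∀ k < N, M *ᵥ e k = M' *ᵥ e k) → M = M' := by
    intro M M' h
    apply Matrix.toLin'.injective
    refine B.ext fun i => ?_
    rw [hB, toLin'_apply, toLin'_apply, h i i.2]
  have heN : e N = 0 := h0
  have heN' : e (N + 1) = 0 := by
    have := hstep N
    rw [heN, mulVec_zero, smul_zero, zero_add] at this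
    exact this.symm
  obtain ⟨P, hP⟩ := key (fun k => if Even k then e k + a⁻¹ • e (k + 1) else 0)
    (by simp [heN, heN'])
  obtain ⟨Q, hQ⟩ := key (fun k => if Even k then 0 else e k + b⁻¹ • e (k + 1))
    (by simp [heN, heN'])
  refine ⟨P, Q, hext _ _ fun k hk => ?_, hext _ _ fun k hk => ?_, hext _ _ fun k hk => ?_⟩
  · rw [← mulVec_mulVec, hP k hk.le]
    split_ifs with h
    · rw [mulVec_add, mulVec_smul, hP k hk.le, hP (k + 1) hk, if_pos h,
        if_neg (by simpa [Nat.even_add_one] using h)]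
      simp
    · simp
  · rw [← mulVec_mulVec, hQ k hk.le]
    split_ifs with h
    · simp
    · rw [mulVec_add, mulVec_smul, hQ k hk.le, hQ (k + 1) hk, if_neg h,
        if_pos (by simpa [Nat.even_add_one] using h)]
      simp
  · rw [add_mulVec, smul_mulVec, smul_mulVec, hP k hk.le, hQ k hk.le, hstep]
    split_ifs with h
    · simp [smul_smul, ha]
    · simp [smul_smul, hb]

theorem Matrix.IsABComposite.symm {a b : K} {A : Matrix m m K} (h : A.IsABComposite a b) :
    A.IsABComposite b a := by
  obtain ⟨P, Q, hP, hQ, rfl⟩ := h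
  exact ⟨Q, P, hQ, hP, add_comm _ _⟩

theorem Matrix.X_sub_C_pow_dvd_of_aeval_mulVec_eq_zero (A : Matrix m m K) (u : m → K) (c : K)
    (p : ℕ) (hp : aeval A ((X - C c) ^ p) *ᵥ u ≠ 0)
    (hp' : aeval A ((X - C c) ^ (p + 1)) *ᵥ u = 0) (g : K[X]) (hg : aeval A g *ᵥ u = 0) :
    (X - C c) ^ (p + 1) ∣ g := by
  classical
  have hmul : ∀ r s : K[X], aeval A s *ᵥ u = 0 → aeval A (r * s) *ᵥ u = 0 := by
    intro r s h
    rw [map_mul, ← mulVec_mulVec, h, mulVec_zero]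
  obtain ⟨j, hj, hassoc⟩ := (dvd_prime_pow (prime_X_sub_C c) _).1
    (EuclideanDomain.gcd_dvd_left ((X - C c) ^ (p + 1)) g)
  have hd : aeval A (EuclideanDomain.gcd ((X - C c) ^ (p + 1)) g) *ᵥ u = 0 := by
    rw [EuclideanDomain.gcd_eq_gcd_ab, map_add, add_mulVec, mul_comm, hmul _ _ hp', mul_comm,
      hmul _ _ hg, add_zero]
  rcases hj.lt_or_eq with hj | rfl
  · obtain ⟨r, hr⟩ := hassoc.dvd.trans (pow_dvd_pow (X - C c) (Nat.lt_succ_iff.1 hj))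
    exact absurd (by rw [hr, mul_comm]; exact hmul _ _ hd) hp
  · exact hassoc.symm.dvd.trans (EuclideanDomain.gcd_dvd_right _ _)

theorem Matrix.aeval_fromBlocks_diagonal {n : Type*} [Fintype n] [DecidableEq n]
    (A : Matrix m m K) (D : Matrix n n K) (g : K[X]) :
    aeval (fromBlocks A 0 0 D) g = fromBlocks (aeval A g) 0 0 (aeval D g) := by
  induction g using Polynomial.induction_on' with
  | add p q hp hq => simp [hp, hq, fromBlocks_add]
  | monomial k c =>
    simp [aeval_monomial, fromBlocks_diagonal_pow, Algebra.algebraMap_eq_smul_one, fromBlocks_smul]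

theorem jordanBlock_aeval_X_sub_C (p : ℕ) (c : K) :
    aeval (jordanBlock p c) (X - C c) =
      Matrix.of fun i j : Fin p => if (i : ℕ) + 1 = (j : ℕ) then 1 else 0 := by
  ext i j
  rw [map_sub, aeval_X, aeval_C, Matrix.sub_apply, algebraMap_matrix_apply, jordanBlock, of_apply,
    of_apply]
  by_cases h : i = j <;> simp [h]

theorem jordanBlock_aeval_pow_mulVec_single_last (p : ℕ) (c : K) (k : ℕ) (hk : k ≤ p) :
    aeval (jordanBlock (p + 1) c) ((X - C c) ^ k) *ᵥ Pi.single (Fin.last p) 1 =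
      Pi.single ⟨p - k, by omega⟩ 1 := by
  induction k with
  | zero => rw [pow_zero, map_one, one_mulVec]; rfl
  | succ k ih =>
    rw [pow_succ', map_mul, ← mulVec_mulVec, ih (by omega), mulVec_single_one,
      jordanBlock_aeval_X_sub_C]
    ext i
    rw [col_apply, of_apply, Pi.single_apply]
    refine if_congr ?_ rfl rfl
    rw [Fin.ext_iff]
    dsimp only
    omega

theorem jordanBlock_aeval_pow_succ_mulVec_single_last (p : ℕ) (c : K) :
    aeval (jordanBlock (p + 1) c) ((X - C c) ^ (p + 1)) *ᵥ Pi.single (Fin.last p) 1 = 0 := by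
  rw [pow_succ', map_mul, ← mulVec_mulVec, jordanBlock_aeval_pow_mulVec_single_last p c p le_rfl,
    mulVec_single_one, jordanBlock_aeval_X_sub_C]
  ext i
  simp

theorem jordanBlock_aeval_mulVec_single_last_eq_zero_iff (p : ℕ) (c : K) (g : K[X]) :
    aeval (jordanBlock (p + 1) c) g *ᵥ Pi.single (Fin.last p) 1 = 0 ↔
      (X - C c) ^ (p + 1) ∣ g := by
  constructor
  · refine Matrix.X_sub_C_pow_dvd_of_aeval_mulVec_eq_zero _ _ c p ?_
      (jordanBlock_aeval_pow_succ_mulVec_single_last p c) g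
    rw [jordanBlock_aeval_pow_mulVec_single_last p c p le_rfl]
    simp
  · rintro ⟨r, rfl⟩
    rw [mul_comm, map_mul, ← mulVec_mulVec, jordanBlock_aeval_pow_succ_mulVec_single_last,
      mulVec_zero]

theorem isABComposite_fromBlocks_jordanBlock {a b c d : K} (ha : a ≠ 0) (hb : b ≠ 0)
    (hcd : c ≠ d) (p q : ℕ)
    (h : alternatingProd a b (p + 1 + (q + 1)) = (X - C c) ^ (p + 1) * (X - C d) ^ (q + 1)) :
    (fromBlocks (jordanBlock (p + 1) c) 0 0 (jordanBlock (q + 1) d)).IsABComposite a b := by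
  have hiff : ∀ g : K[X], aeval (fromBlocks (jordanBlock (p + 1) c) 0 0 (jordanBlock (q + 1) d)) g
      *ᵥ Sum.elim (Pi.single (Fin.last p) 1) (Pi.single (Fin.last q) 1) = 0 ↔
      alternatingProd a b (Fintype.card (Fin (p + 1) ⊕ Fin (q + 1))) ∣ g := by
    intro g
    have hcop : IsCoprime ((X - C c) ^ (p + 1)) ((X - C d) ^ (q + 1)) :=
      (isCoprime_X_sub_C_of_isUnit_sub (sub_ne_zero.2 hcd).isUnit).pow
    have hiff_dvd : (X - C c) ^ (p + 1) * (X - C d) ^ (q + 1) ∣ g ↔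
        (X - C c) ^ (p + 1) ∣ g ∧ (X - C d) ^ (q + 1) ∣ g :=
      ⟨fun hg => ⟨dvd_of_mul_right_dvd hg, dvd_of_mul_left_dvd hg⟩,
        fun hg => hcop.mul_dvd hg.1 hg.2⟩
    rw [Fintype.card_sum, Fintype.card_fin, Fintype.card_fin, h, hiff_dvd,
      ← jordanBlock_aeval_mulVec_single_last_eq_zero_iff,
      ← jordanBlock_aeval_mulVec_single_last_eq_zero_iff, Matrix.aeval_fromBlocks_diagonal,
      fromBlocks_mulVec, ← Sum.elim_zero_zero, Sum.elim_eq_iff, zero_mulVec, zero_mulVec, add_zero,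
      zero_add, Sum.elim_comp_inl, Sum.elim_comp_inr]
  exact isABComposite_of_cyclic ha hb _ _ ((hiff _).2 dvd_rfl) fun g => (hiff g).1

end

/-- Each of `diag(J_α(n), J_β(n))`, `diag(J_α(n), J_β(n+1))` and `diag(J_α(n+1), J_β(n))`
is an `(α,β)`-composite (for `α ≠ β` both nonzero, `n ≥ 1`). -/
theorem jordan_pairs_isABComposite
    {K : Type*} [Field K] (α β : K) (hα : α ≠ 0) (hβ : β ≠ 0) (hne : α ≠ β)
    (n : ℕ) (hn : 1 ≤ n) :
    Matrix.IsABComposite α β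
        (Matrix.fromBlocks (jordanBlock n α) 0 0 (jordanBlock n β)) ∧
      Matrix.IsABComposite α β
        (Matrix.fromBlocks (jordanBlock n α) 0 0 (jordanBlock (n + 1) β)) ∧
      Matrix.IsABComposite α β
        (Matrix.fromBlocks (jordanBlock (n + 1) α) 0 0 (jordanBlock n β)) := by
  obtain ⟨n, rfl⟩ : ∃ k, n = k + 1 := ⟨n - 1, by omega⟩
  refine ⟨?_, (Matrix.IsABComposite.symm ?_), ?_⟩
  · apply isABComposite_fromBlocks_jordanBlock hα hβ hne
    rw [← two_mul, alternatingProd_two_mul]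
  · apply isABComposite_fromBlocks_jordanBlock hβ hα hne
    rw [show n + 1 + (n + 1 + 1) = 2 * (n + 1) + 1 by ring, alternatingProd_two_mul_add_one,
      mul_comm]
  · apply isABComposite_fromBlocks_jordanBlock hα hβ hne
    rw [show n + 1 + 1 + (n + 1) = 2 * (n + 1) + 1 by ring, alternatingProd_two_mul_add_one]
end
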